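/- Let A = (a_{ij}) be a 2k×2k symmetric homogeneous matrix of non-negative integers with trace tr(A) = 2d. Then a general homogeneous form F of degree d in four variables over ℂ can be written as the sum of the Pfaffians of k skew-symmetric 2k×2k matrices of homogeneous forms, each with degree matrix A. Equivalently, s(A) ≤ k, where s(A) is the least number of Pfaffians of matrices with degree matrix A needed to express a general form of degree d. -/

import Mathlib

open MvPolynomial

/-- The Pfaffian of a `2n × 2n` matrix of multivariate polynomials over `ℂ`,
given by the standard averaged signed sum over permutations. -/
noncomputable def pfaff {σ : Type*} {n : ℕ}
    (M : Matrix (Fin (2*n)) (Fin (2*n)) (MvPolynomial σ ℂ)) : MvPolynomial σ ℂ :=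
  (((2^n * n.factorial : ℕ) : ℂ)⁻¹) •
    ∑ p : Equiv.Perm (Fin (2*n)),
      (Equiv.Perm.sign p : ℤ) •
        ∏ i : Fin n, M (p ⟨2*i.1, by have := i.2; omega⟩) (p ⟨2*i.1+1, by have := i.2; omega⟩)

/-- A square matrix of polynomials is skew-symmetric. -/
def IsSkew {m : Type*} {R : Type*} [Ring R] (M : Matrix m m R) : Prop :=
  ∀ i j, M j i = - M i j

/-- A square integer matrix is homogeneous. -/
def HomogMat {m : Type*} (A : Matrix m m ℕ) : Prop :=
  ∀ i j l r, A i j + A l r = A i r + A l j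

/-- A matrix of polynomials has degree matrix `A`. -/
def DegMat {σ m : Type*} (M : Matrix m m (MvPolynomial σ ℂ)) (A : Matrix m m ℕ) : Prop :=
  ∀ i j, (M i j).IsHomogeneous (A i j)

/-- The set of submaximal Pfaffians of a skew-symmetric matrix of even size `2k`:
Pfaffians of the submatrices obtained by erasing two rows and the two columns
with the same indexes. -/
def submaxPfEven {σ : Type*} {k : ℕ}
    (M : Matrix (Fin (2*k)) (Fin (2*k)) (MvPolynomial σ ℂ)) : Set (MvPolynomial σ ℂ) :=
  { q | ∃ e : Fin (2*(k-1)) ↪o Fin (2*k), q = pfaff (M.submatrix e e) }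

/-- The set of submaximal Pfaffians of a skew-symmetric matrix of odd size `2k-1`:
Pfaffians of the submatrices obtained by erasing one row and the column
with the same index. -/
def submaxPfOdd {σ : Type*} {k : ℕ}
    (M : Matrix (Fin (2*k-1)) (Fin (2*k-1)) (MvPolynomial σ ℂ)) : Set (MvPolynomial σ ℂ) :=
  { q | ∃ e : Fin (2*(k-1)) ↪o Fin (2*k-1), q = pfaff (M.submatrix e e) }

section HomogeneousIdeals

variable {σ : Type*}

/-- The ideal `I` contains every form of degree `d`. -/
def ContainsForms (d : ℕ) (I : Ideal (MvPolynomial σ ℂ)) : Prop :=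
  ∀ F : MvPolynomial σ ℂ, F.IsHomogeneous d → F ∈ I

theorem ContainsForms.mono {d : ℕ} {I J : Ideal (MvPolynomial σ ℂ)} (hIJ : I ≤ J)
    (h : ContainsForms d I) : ContainsForms d J :=
  fun F hF => hIJ (h F hF)

theorem containsForms_of_monomial_mem {d : ℕ} {I : Ideal (MvPolynomial σ ℂ)}
    (h : ∀ m : σ →₀ ℕ, m.degree = d → monomial m (1 : ℂ) ∈ I) : ContainsForms d I := by
  intro F hF
  rw [F.as_sum]
  refine I.sum_mem fun m hm => ?_
  have h1 : monomial m (coeff m F) = C (coeff m F) * monomial m (1 : ℂ) := by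
    rw [C_mul_monomial, mul_one]
  rw [h1]
  refine I.mul_mem_left _ (h m ?_)
  by_contra hne
  exact (mem_support_iff.mp hm) (hF.coeff_eq_zero hne)

theorem homogeneousComponent_add_mul {g : MvPolynomial σ ℂ} {e : ℕ} (hg : g.IsHomogeneous e)
    (c : MvPolynomial σ ℂ) (n : ℕ) :
    homogeneousComponent (n + e) (c * g) = homogeneousComponent n c * g := by
  conv_lhs => rw [← sum_homogeneousComponent c, Finset.sum_mul, map_sum]
  have h1 : ∀ i, homogeneousComponent (n + e) (homogeneousComponent i c * g) =
      if i = n then homogeneousComponent n c * g else 0 := by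
    intro i
    rw [homogeneousComponent_of_mem (m := n + e) (n := i + e)
      ((homogeneousComponent_isHomogeneous i c).mul hg)]
    by_cases h : i = n
    · simp [h]
    · rw [if_neg (by omega), if_neg h]
  simp_rw [h1]
  rw [Finset.sum_ite_eq']
  split_ifs with h
  · rfl
  · rw [homogeneousComponent_eq_zero _ _ (by simpa using h), zero_mul]

theorem homogeneousComponent_mul_of_lt {g : MvPolynomial σ ℂ} {e : ℕ} (hg : g.IsHomogeneous e)
    (c : MvPolynomial σ ℂ) {n : ℕ} (hn : n < e) :
    homogeneousComponent n (c * g) = 0 := by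
  conv_lhs => rw [← sum_homogeneousComponent c, Finset.sum_mul, map_sum]
  refine Finset.sum_eq_zero fun i _ => ?_
  rw [homogeneousComponent_of_mem (m := n) (n := i + e)
      ((homogeneousComponent_isHomogeneous i c).mul hg), if_neg (by omega)]

theorem exists_homogeneous_coeffs {ι : Type*} [Fintype ι] {g : ι → MvPolynomial σ ℂ} {e : ι → ℕ}
    (hg : ∀ i, (g i).IsHomogeneous (e i)) {d : ℕ} {F : MvPolynomial σ ℂ} (hF : F.IsHomogeneous d)
    (hmem : F ∈ Ideal.span (Set.range g)) :
    ∃ h : ι → MvPolynomial σ ℂ,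
      (∀ i, h i = 0 ∨ ∃ n, n + e i = d ∧ (h i).IsHomogeneous n) ∧ ∑ i, h i * g i = F := by
  obtain ⟨c, hc⟩ := Ideal.mem_span_range_iff_exists_fun.mp hmem
  refine ⟨fun i => if e i ≤ d then homogeneousComponent (d - e i) (c i) else 0, fun i => ?_, ?_⟩
  · by_cases h : e i ≤ d
    · right
      exact ⟨d - e i, by omega, by simpa [h] using homogeneousComponent_isHomogeneous _ _⟩
    · left
      simp [h]
  · rw [← homogeneousComponent_eq_self hF, ← hc, map_sum]
    refine Finset.sum_congr rfl fun i _ => ?_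
    by_cases h : e i ≤ d
    · simp only [if_pos h]
      rw [← homogeneousComponent_add_mul (hg i), Nat.sub_add_cancel h]
    · simp only [if_neg h]
      rw [zero_mul, homogeneousComponent_mul_of_lt (hg i) _ (by omega)]

theorem containsForms_succ {ι : Type*} [Fintype ι] {g : ι → MvPolynomial σ ℂ} {e : ι → ℕ}
    (hg : ∀ i, (g i).IsHomogeneous (e i)) {d : ℕ} {l : MvPolynomial σ ℂ} (hl : l.IsHomogeneous 1)
    (h1 : ContainsForms (d + 1) (Ideal.span (Set.range g) ⊔ Ideal.span {l}))
    (h2 : ∀ H : MvPolynomial σ ℂ, H.IsHomogeneous d → l * H ∈ Ideal.span (Set.range g)) :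
    ContainsForms (d + 1) (Ideal.span (Set.range g)) := by
  intro F hF
  have hr : Ideal.span (Set.range g) ⊔ Ideal.span {l} =
      Ideal.span (Set.range fun o : Option ι => o.elim l g) := by
    rw [← Ideal.span_union]
    congr 1
    ext x
    simp [Option.exists, eq_comm]
  have hF' := h1 F hF
  rw [hr] at hF'
  obtain ⟨h, hh, hs⟩ := exists_homogeneous_coeffs (e := fun o : Option ι => o.elim 1 e)
    (by rintro (_ | i); exacts [hl, hg i]) hF hF'
  rw [Fintype.sum_option] at hs
  rw [← hs]
  refine Ideal.add_mem _ ?_ (Ideal.sum_mem _ fun i _ =>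
    Ideal.mul_mem_left _ _ (Ideal.subset_span ⟨i, rfl⟩))
  rw [mul_comm]
  refine h2 _ ?_
  rcases hh none with h0 | ⟨n, hn, hn'⟩
  · rw [h0]
    exact isHomogeneous_zero _ _ _
  · have : n = d := by simpa using hn
    exact this ▸ hn'

/-- Containing all forms of degree `d` is an open condition along a polynomial curve of
homogeneous ideals. -/
theorem finite_setOf_not_containsForms [Finite σ] {ι : Type*} [Fintype ι]
    (G : ι → Polynomial (MvPolynomial σ ℂ)) {e : ι → ℕ}
    (hG : ∀ (s : ℂ) i, ((G i).eval (C s)).IsHomogeneous (e i)) {d : ℕ} {s₀ : ℂ}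
    (h : ContainsForms d (Ideal.span (Set.range fun i => (G i).eval (C s₀)))) :
    {s : ℂ | ¬ ContainsForms d (Ideal.span (Set.range fun i => (G i).eval (C s)))}.Finite := by
  classical
  have : Finite {m : σ →₀ ℕ // m.degree = d} := (Finsupp.finite_of_degree_eq d).to_subtype
  have := Fintype.ofFinite {m : σ →₀ ℕ // m.degree = d}
  set κ := {m : σ →₀ ℕ // m.degree = d}
  have hex (β : κ) := exists_homogeneous_coeffs (hG s₀)
    (isHomogeneous_monomial (1 : ℂ) β.2) (h _ (isHomogeneous_monomial (1 : ℂ) β.2))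
  choose c hc hcs using hex
  let F : κ → Polynomial (MvPolynomial σ ℂ) := fun β => ∑ i, Polynomial.C (c β i) * G i
  have hF : ∀ β s, (F β).eval (C s) = ∑ i, c β i * (G i).eval (C s) := by
    intro β s
    simp [F, Polynomial.eval_finsetSum]
  have hFhom : ∀ β s, ((F β).eval (C s)).IsHomogeneous d := by
    intro β s
    rw [hF]
    refine IsHomogeneous.sum _ _ _ fun i _ => ?_
    rcases hc β i with h0 | ⟨n, hn, hn'⟩
    · rw [h0, zero_mul]
      exact isHomogeneous_zero _ _ _
    · exact hn ▸ hn'.mul (hG s i)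
  let T : Matrix κ κ (Polynomial ℂ) := Matrix.of fun β γ =>
    ∑ i ∈ (F β).support, Polynomial.C (coeff γ.1 ((F β).coeff i)) * Polynomial.X ^ i
  have hT : ∀ β γ s, (T β γ).eval s = coeff γ.1 ((F β).eval (C s)) := by
    intro β γ s
    simp only [T, Matrix.of_apply]
    rw [Polynomial.eval_finsetSum, (F β).eval_eq_sum, Polynomial.sum, coeff_sum]
    refine Finset.sum_congr rfl fun i _ => ?_
    rw [← C_pow, mul_comm ((F β).coeff i), coeff_C_mul,
      Polynomial.eval_mul, Polynomial.eval_C, Polynomial.eval_pow, Polynomial.eval_X, mul_comm]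
  have hdet : ∀ s, T.det.eval s = (T.map (Polynomial.eval s)).det := by
    intro s
    exact (Polynomial.evalRingHom s).map_det T
  have hT0 : T.det ≠ 0 := by
    intro h0
    have h1 := hdet s₀
    have h2 : T.map (Polynomial.eval s₀) = 1 := by
      ext β γ
      rw [Matrix.map_apply, hT, hF, hcs, coeff_monomial, Matrix.one_apply]
      by_cases hβ : β = γ
      · simp [hβ]
      · rw [if_neg hβ, if_neg fun h => hβ (Subtype.ext h)]
    rw [h2, h0] at h1
    simp at h1
  refine (Polynomial.finite_setOfPred_isRoot hT0).subset fun s hs => ?_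
  by_contra hroot
  refine hs (containsForms_of_monomial_mem fun m hm => ?_)
  have hu : IsUnit (T.map (Polynomial.eval s)).det := by
    rw [← hdet]
    exact isUnit_iff_ne_zero.mpr hroot
  set B := T.map (Polynomial.eval s)
  have hexp : ∀ β, (F β).eval (C s) = ∑ γ : κ, C (B β γ) * monomial γ.1 (1 : ℂ) := by
    intro β
    ext m'
    simp_rw [coeff_sum, coeff_C_mul, coeff_monomial]
    by_cases hm' : m'.degree = d
    · rw [Finset.sum_eq_single (⟨m', hm'⟩ : κ)]
      · simp [B, hT]
      · intro γ _ hγ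
        rw [if_neg (fun h => hγ (Subtype.ext h)), mul_zero]
      · simp
    · rw [(hFhom β s).coeff_eq_zero hm']
      refine (Finset.sum_eq_zero fun γ _ => ?_).symm
      rw [if_neg (fun h : γ.1 = m' => hm' (h ▸ γ.2)), mul_zero]
  have hinv : monomial m (1 : ℂ) = ∑ β : κ, C (B⁻¹ ⟨m, hm⟩ β) * (F β).eval (C s) := by
    simp_rw [hexp, Finset.mul_sum, ← mul_assoc, ← C_mul]
    rw [Finset.sum_comm]
    simp_rw [← Finset.sum_mul, ← map_sum, ← Matrix.mul_apply, Matrix.nonsing_inv_mul _ hu]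
    rw [Finset.sum_eq_single (⟨m, hm⟩ : κ)]
    · simp
    · intro γ _ hγ
      rw [Matrix.one_apply_ne' hγ, C_0, zero_mul]
    · simp
  rw [hinv]
  refine Ideal.sum_mem _ fun β _ => Ideal.mul_mem_left _ _ ?_
  rw [hF]
  exact Ideal.sum_mem _ fun i _ => Ideal.mul_mem_left _ _ (Ideal.subset_span ⟨i, rfl⟩)

end HomogeneousIdeals

section Cofactors

variable {n : Type*} [Fintype n] [DecidableEq n]

theorem adjugate_updateRow_self {R : Type*} [CommRing R] (A : Matrix n n R) (i j : n) (u : n → R) :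
    (A.updateRow i u).adjugate j i = A.adjugate j i := by
  rw [Matrix.adjugate_apply, Matrix.adjugate_apply, Matrix.updateRow_idem]

theorem adjugate_updateRow_smul {R : Type*} [CommRing R] (A : Matrix n n R) {i r : n} (hr : r ≠ i)
    (j : n) (x : R) :
    (A.updateRow i (x • A i)).adjugate j r = x * A.adjugate j r := by
  rw [Matrix.adjugate_apply, Matrix.adjugate_apply, Matrix.updateRow_comm _ hr.symm,
    Matrix.det_updateRow_smul]
  congr 2
  ext a b
  by_cases ha : a = i
  · subst ha
    rw [Matrix.updateRow_self, Matrix.updateRow_ne hr.symm]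
  · rw [Matrix.updateRow_ne ha]

theorem adjugate_updateCol_self {R : Type*} [CommRing R] (A : Matrix n n R) (i j : n) (u : n → R) :
    (A.updateCol j u).adjugate j i = A.adjugate j i := by
  rw [← Matrix.transpose_apply (Matrix.adjugate _), ← Matrix.transpose_apply A.adjugate,
    Matrix.adjugate_transpose, Matrix.adjugate_transpose, Matrix.updateRow_transpose.symm,
    adjugate_updateRow_self]

theorem adjugate_updateCol_smul {R : Type*} [CommRing R] (A : Matrix n n R) {j l : n} (hl : l ≠ j)
    (i : n) (x : R) :
    (A.updateCol j (x • A.col j)).adjugate l i = x * A.adjugate l i := by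
  rw [← Matrix.transpose_apply (Matrix.adjugate _), ← Matrix.transpose_apply A.adjugate,
    Matrix.adjugate_transpose, Matrix.adjugate_transpose, Matrix.updateRow_transpose.symm,
    ← adjugate_updateRow_smul _ hl]
  rfl

variable {σ : Type*}

/-- The entry of `M` in position `(i, j)` is a form of degree `b i + c j`. -/
def HasDegrees (M : Matrix n n (MvPolynomial σ ℂ)) (b c : n → ℕ) : Prop :=
  ∀ i j, (M i j).IsHomogeneous (b i + c j)

theorem HasDegrees.adjugate {M : Matrix n n (MvPolynomial σ ℂ)} {b c : n → ℕ}
    (hM : HasDegrees M b c) {i j : n} {e : ℕ} (he : e + (b i + c j) = ∑ r, b r + ∑ r, c r) :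
    (M.adjugate j i).IsHomogeneous e := by
  rw [Matrix.adjugate_apply, Matrix.det_apply]
  refine IsHomogeneous.sum _ _ _ fun p _ => ?_
  suffices h : (∏ k, M.updateRow i (Pi.single j 1) (p k) k).IsHomogeneous e by
    rcases Int.units_eq_one_or (Equiv.Perm.sign p) with h1 | h1
    · rwa [h1, one_smul]
    · rw [h1, Units.neg_smul, one_smul]
      exact h.neg
  by_cases hp : p j = i
  · have h := IsHomogeneous.prod Finset.univ (fun k => M.updateRow i (Pi.single j 1) (p k) k)
      (fun k => if k = j then 0 else b (p k) + c k) (fun k _ => by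
        by_cases hk : k = j
        · subst hk
          simpa [hp] using isHomogeneous_one _ _
        · have : p k ≠ i := fun h => hk (p.injective (h.trans hp.symm))
          simpa [hk, this] using hM (p k) k)
    convert h using 1
    have h2 : ∑ k, (b (p k) + c k) = ∑ r, b r + ∑ r, c r := by
      rw [Finset.sum_add_distrib, Equiv.sum_comp p b]
    have h3 : ∑ k, (b (p k) + c k) = (∑ k, if k = j then 0 else b (p k) + c k) + (b i + c j) := by
      rw [← hp, ← Finset.add_sum_erase _ _ (Finset.mem_univ j),
        ← Finset.add_sum_erase _ _ (Finset.mem_univ j), if_pos rfl, zero_add, add_comm]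
      congr 1
      exact Finset.sum_congr rfl fun k hk => (if_neg (Finset.ne_of_mem_erase hk)).symm
    omega
  · have : ∏ k, M.updateRow i (Pi.single j 1) (p k) k = 0 := by
      refine Finset.prod_eq_zero (Finset.mem_univ (p.symm i)) ?_
      have h1 : p.symm i ≠ j := fun h => hp (by rw [← h]; simp)
      simp [h1]
    rw [this]
    exact isHomogeneous_zero _ _ _

variable {τ : Type*} [Fintype τ]

/-- The cofactors of the matrices `M t` at the positions in `S`, together with the variables
in `E`. -/
noncomputable def cofactorFamily (M : τ → Matrix n n (MvPolynomial σ ℂ)) (S : Set (n × n))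
    (E : Set σ) : (τ × S) ⊕ E → MvPolynomial σ ℂ :=
  Sum.elim (fun p => (M p.1).adjugate p.2.1.2 p.2.1.1) (fun v => X v.1)

/-- The ideal generated by the cofactors of the matrices `M t` at the positions in `S`, together
with the variables in `E`. -/
noncomputable def cofactorIdeal (M : τ → Matrix n n (MvPolynomial σ ℂ)) (S : Set (n × n))
    (E : Set σ) : Ideal (MvPolynomial σ ℂ) :=
  Ideal.span (Set.range (cofactorFamily M S E))

omit [Fintype τ] in
theorem adjugate_mem_cofactorIdeal (M : τ → Matrix n n (MvPolynomial σ ℂ)) {S : Set (n × n)}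
    (E : Set σ) (t : τ) {i j : n} (h : (i, j) ∈ S) :
    (M t).adjugate j i ∈ cofactorIdeal M S E :=
  Ideal.subset_span ⟨Sum.inl (t, ⟨(i, j), h⟩), rfl⟩

omit [Fintype τ] in
theorem X_mem_cofactorIdeal (M : τ → Matrix n n (MvPolynomial σ ℂ)) (S : Set (n × n))
    {E : Set σ} {v : σ} (h : v ∈ E) : X v ∈ cofactorIdeal M S E :=
  Ideal.subset_span ⟨Sum.inr ⟨v, h⟩, rfl⟩

omit [Fintype τ] in
theorem cofactorIdeal_le {M : τ → Matrix n n (MvPolynomial σ ℂ)} {S : Set (n × n)}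
    {E : Set σ} {I : Ideal (MvPolynomial σ ℂ)}
    (h1 : ∀ t i j, (i, j) ∈ S → (M t).adjugate j i ∈ I) (h2 : ∀ v ∈ E, X v ∈ I) :
    cofactorIdeal M S E ≤ I := by
  refine Ideal.span_le.mpr ?_
  rintro _ ⟨⟨t, ⟨⟨i, j⟩, hp⟩⟩ | ⟨v, hv⟩, rfl⟩
  exacts [h1 t i j hp, h2 v hv]

omit [Fintype τ] in
theorem mul_mem_of_mem_cofactorIdeal {M : τ → Matrix n n (MvPolynomial σ ℂ)} {S : Set (n × n)}
    {E : Set σ} {I : Ideal (MvPolynomial σ ℂ)} {l : MvPolynomial σ ℂ}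
    (h1 : ∀ t i j, (i, j) ∈ S → l * (M t).adjugate j i ∈ I) (h2 : ∀ v ∈ E, X v ∈ I)
    {H : MvPolynomial σ ℂ} (hH : H ∈ cofactorIdeal M S E) : l * H ∈ I := by
  have h : cofactorIdeal M S E ≤ Submodule.comap (LinearMap.mulLeft (MvPolynomial σ ℂ) l) I :=
    cofactorIdeal_le h1 fun v hv => I.mul_mem_left l (h2 v hv)
  exact h hH

omit [DecidableEq n] in
theorem sum_add_sum_sub_add (b c : n → ℕ) (i j : n) :
    ∑ r, b r + ∑ r, c r - (b i + c j) + (b i + c j) = ∑ r, b r + ∑ r, c r :=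
  Nat.sub_add_cancel (add_le_add (Finset.single_le_sum (fun _ _ => Nat.zero_le _)
    (Finset.mem_univ i)) (Finset.single_le_sum (fun _ _ => Nat.zero_le _) (Finset.mem_univ j)))

/-- The degrees of the members of `cofactorFamily`. -/
def cofactorDegree (τ : Type*) (b c : n → ℕ) (S : Set (n × n)) (E : Set σ) : (τ × S) ⊕ E → ℕ :=
  Sum.elim (fun p => ∑ r, b r + ∑ r, c r - (b p.2.1.1 + c p.2.1.2)) (fun _ => 1)

omit [Fintype τ] in
theorem isHomogeneous_cofactorFamily {M : τ → Matrix n n (MvPolynomial σ ℂ)} {b c : n → ℕ}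
    (hM : ∀ t, HasDegrees (M t) b c) (S : Set (n × n)) (E : Set σ) (p : (τ × S) ⊕ E) :
    (cofactorFamily M S E p).IsHomogeneous (cofactorDegree τ b c S E p) := by
  rcases p with p | v
  · exact (hM p.1).adjugate (sum_add_sum_sub_add b c _ _)
  · exact isHomogeneous_X _ _

theorem finite_setOf_not_containsForms_cofactorIdeal [Finite σ]
    {M₀ M₁ : τ → Matrix n n (MvPolynomial σ ℂ)} {b c : n → ℕ}
    (hM₀ : ∀ t, HasDegrees (M₀ t) b c) (hM₁ : ∀ t, HasDegrees (M₁ t) b c) {S : Set (n × n)}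
    {E : Set σ} {d : ℕ} (h : ContainsForms d (cofactorIdeal M₀ S E)) :
    {s : ℂ | ¬ ContainsForms d (cofactorIdeal (fun t => M₀ t +
      (C s : MvPolynomial σ ℂ) • M₁ t) S E)}.Finite := by
  classical
  have := Fintype.ofFinite S
  have := Fintype.ofFinite E
  let N : τ → Matrix n n (Polynomial (MvPolynomial σ ℂ)) := fun t =>
    (M₀ t).map Polynomial.C + (Polynomial.X : Polynomial (MvPolynomial σ ℂ)) • (M₁ t).map Polynomial.C
  let G : (τ × S) ⊕ E → Polynomial (MvPolynomial σ ℂ) :=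
    Sum.elim (fun p => (N p.1).adjugate p.2.1.2 p.2.1.1) (fun v => Polynomial.C (X v.1))
  have hG : ∀ s : ℂ, (fun p => (G p).eval (C s)) =
      cofactorFamily (fun t => M₀ t + (C s : MvPolynomial σ ℂ) • M₁ t) S E := by
    intro s
    funext p
    rcases p with p | v
    · have h1 := congrFun (congrFun ((Polynomial.evalRingHom (C s)).map_adjugate (N p.1))
        p.2.1.2) p.2.1.1
      have h2 : (Polynomial.evalRingHom (C s)).mapMatrix (N p.1) = M₀ p.1 + (C s : MvPolynomial σ ℂ) • M₁ p.1 := by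
        refine Matrix.ext fun i j => ?_
        simp [N]
        exact mul_comm _ _
      rw [h2] at h1
      exact h1
    · simp [G, cofactorFamily]
  refine (finite_setOf_not_containsForms G (e := cofactorDegree τ b c S E) (s₀ := 0) (d := d)
    (fun s p => ?_) ?_).subset fun s hs => ?_
  · rw [congrFun (hG s) p]
    refine isHomogeneous_cofactorFamily (fun t i j => ?_) S E p
    exact (hM₀ t i j).add ((hM₁ t i j).C_mul s)
  · rw [hG]
    simpa [cofactorIdeal] using h
  · rw [Set.mem_ofPred_eq, hG]
    exact hs

theorem exists_containsForms_and [Finite σ]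
    {M₀ M₁ : τ → Matrix n n (MvPolynomial σ ℂ)} {b c : n → ℕ}
    (hM₀ : ∀ t, HasDegrees (M₀ t) b c) (hM₁ : ∀ t, HasDegrees (M₁ t) b c) {S₀ S₁ : Set (n × n)}
    {E₀ E₁ : Set σ} {d₀ d₁ : ℕ} (h₀ : ContainsForms d₀ (cofactorIdeal M₀ S₀ E₀))
    (h₁ : ContainsForms d₁ (cofactorIdeal M₁ S₁ E₁)) :
    ∃ M : τ → Matrix n n (MvPolynomial σ ℂ), (∀ t, HasDegrees (M t) b c) ∧
      ContainsForms d₀ (cofactorIdeal M S₀ E₀) ∧ ContainsForms d₁ (cofactorIdeal M S₁ E₁) := by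
  have hD : ∀ t, HasDegrees (M₁ t + (C (-1 : ℂ) : MvPolynomial σ ℂ) • M₀ t) b c := fun t i j =>
    (hM₁ t i j).add ((hM₀ t i j).C_mul _)
  have hf₀ := finite_setOf_not_containsForms_cofactorIdeal hM₀ hD h₀
  have hD' : ∀ t, HasDegrees (M₀ t + (C (-1 : ℂ) : MvPolynomial σ ℂ) • M₁ t) b c := fun t i j =>
    (hM₀ t i j).add ((hM₁ t i j).C_mul _)
  have hf₁ := finite_setOf_not_containsForms_cofactorIdeal hM₁ hD' h₁
  have hinj : Function.Injective fun s : ℂ => 1 - s := sub_right_injective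
  obtain ⟨s, hs⟩ := (hf₀.union (hf₁.preimage hinj.injOn)).exists_notMem
  simp only [Set.mem_union, Set.mem_preimage, Set.mem_ofPred_eq, not_or, not_not] at hs
  refine ⟨_, fun t i j => (hM₀ t i j).add ((hD t i j).C_mul s), hs.1, ?_⟩
  convert hs.2 using 2
  congr 1
  funext t
  refine Matrix.ext fun i j => ?_
  simp only [C_sub, C_neg, C_1, Matrix.add_apply, Matrix.smul_apply, smul_eq_mul]
  ring

end Cofactors

section MonomialMatrices

theorem exists_add_eq_and_sum_eq {ι : Type*} (s : Finset ι) (f : ι → ℕ) {x y : ℕ}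
    (h : ∑ r ∈ s, f r = x + y) :
    ∃ u v : ι → ℕ, (∀ r ∈ s, u r + v r = f r) ∧ ∑ r ∈ s, u r = x ∧ ∑ r ∈ s, v r = y := by
  classical
  induction s using Finset.induction_on generalizing x y with
  | empty =>
    rw [Finset.sum_empty] at h
    exact ⟨0, 0, by simp, by rw [Finset.sum_empty]; omega, by rw [Finset.sum_empty]; omega⟩
  | insert r s hr ih =>
    rw [Finset.sum_insert hr] at h
    obtain ⟨u, v, h1, h2, h3⟩ := @ih (x - min x (f r)) (y - (f r - min x (f r))) (by omega)
    have hne : ∀ t ∈ s, t ≠ r := fun t ht h => hr (h ▸ ht)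
    refine ⟨Function.update u r (min x (f r)), Function.update v r (f r - min x (f r)), ?_, ?_, ?_⟩
    · intro t ht
      rcases Finset.mem_insert.mp ht with rfl | ht
      · simp
      · simpa [hne t ht] using h1 t ht
    · rw [Finset.sum_insert hr, Finset.sum_congr rfl fun t ht => Function.update_of_ne (hne t ht) _ _,
        h2, Function.update_self]
      omega
    · rw [Finset.sum_insert hr, Finset.sum_congr rfl fun t ht => Function.update_of_ne (hne t ht) _ _,
        h3, Function.update_self]
      omega

variable {n : Type*} [Fintype n] [DecidableEq n]

theorem adjugate_diagonal_submatrix {R : Type*} [CommRing R] (w : n → R) (p : Equiv.Perm n)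
    (i : n) :
    ((Matrix.diagonal w).submatrix id p.symm).adjugate (p i) i =
      (Equiv.Perm.sign p : ℤ) * ∏ r ∈ Finset.univ.erase i, w r := by
  have h : ((Matrix.diagonal w).submatrix id p.symm).updateRow i (Pi.single (p i) 1) =
      (Matrix.diagonal (Function.update w i 1)).submatrix id p.symm := by
    ext r s
    by_cases hr : r = i
    · subst hr
      rw [Matrix.updateRow_self]
      by_cases hs : s = p r
      · simp [hs]
      · have : r ≠ p.symm s := fun h => hs (by rw [h]; simp)
        simp [hs, Matrix.diagonal_apply_ne _ this]
    · simp [Matrix.updateRow_ne hr, Matrix.diagonal_apply, Function.update_of_ne hr]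
  rw [Matrix.adjugate_apply, h, Matrix.det_permute', Matrix.det_diagonal, Equiv.Perm.sign_symm,
    ← Finset.mul_prod_erase _ _ (Finset.mem_univ i), Function.update_self, one_mul]
  congr 1
  exact Finset.prod_congr rfl fun r hr => Function.update_of_ne (Finset.ne_of_mem_erase hr) _ _

theorem exists_hasDegrees_adjugate_eq {σ : Type*} (v₀ v₁ : σ) (b c : n → ℕ) (i j : n) {x y : ℕ}
    (h : x + y + (b i + c j) = ∑ r, b r + ∑ r, c r) :
    ∃ M : Matrix n n (MvPolynomial σ ℂ), HasDegrees M b c ∧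
      ∃ ε : ℤˣ, M.adjugate j i = ((ε : ℤ) : MvPolynomial σ ℂ) * (X v₀ ^ x * X v₁ ^ y) := by
  obtain ⟨p, rfl⟩ : ∃ p : Equiv.Perm n, p i = j := ⟨_, Equiv.swap_apply_left i j⟩
  have h1 : ∑ r ∈ Finset.univ.erase i, (b r + c (p r)) = x + y := by
    have h2 := Finset.add_sum_erase Finset.univ (fun r => b r + c (p r)) (Finset.mem_univ i)
    have h3 : ∑ r, (b r + c (p r)) = ∑ r, b r + ∑ r, c r := by
      rw [Finset.sum_add_distrib, Equiv.sum_comp p c]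
    omega
  obtain ⟨u, v, huv, hu, hv⟩ := exists_add_eq_and_sum_eq _ _ h1
  let w : n → MvPolynomial σ ℂ := fun r => if r = i then 0 else X v₀ ^ u r * X v₁ ^ v r
  refine ⟨(Matrix.diagonal w).submatrix id p.symm, fun r s => ?_, Equiv.Perm.sign p, ?_⟩
  · rw [Matrix.submatrix_apply, Matrix.diagonal_apply]
    split_ifs with hrs
    · simp only [id_eq, w]
      split_ifs with hr
      · exact isHomogeneous_zero _ _ _
      · have hs : s = p r := by rw [← id_eq r, hrs]; simp
        rw [hs, ← huv r (by simp [hr])]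
        simpa using ((isHomogeneous_X ℂ v₀).pow (u r)).mul ((isHomogeneous_X ℂ v₁).pow (v r))
    · exact isHomogeneous_zero _ _ _
  · rw [adjugate_diagonal_submatrix]
    congr 1
    rw [← hu, ← hv, ← Finset.prod_pow_eq_pow_sum, ← Finset.prod_pow_eq_pow_sum,
      ← Finset.prod_mul_distrib]
    exact Finset.prod_congr rfl fun r hr => if_neg (Finset.ne_of_mem_erase hr)

theorem exists_containsForms_single {τ : Type*} [Fintype τ] (b c : n → ℕ) (i j : n) {d : ℕ}
    (hd : ∑ r, b r + ∑ r, c r = d) (h : d < Fintype.card τ * (b i + c j + 1)) :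
    ∃ M : τ → Matrix n n (MvPolynomial (Fin 4) ℂ), (∀ t, HasDegrees (M t) b c) ∧
      ContainsForms d (cofactorIdeal M {(i, j)} {2, 3}) := by
  set a := b i + c j
  have had : d - a + a = d := by
    rw [← hd]
    exact sum_add_sum_sub_add b c i j
  let e := Fintype.equivFin τ
  let x : τ → ℕ := fun t => min (e t * (a + 1)) (d - a)
  have hx : ∀ t, x t ≤ d - a := fun t => min_le_right _ _
  choose M hM ε hε using fun t => exists_hasDegrees_adjugate_eq (0 : Fin 4) 1 b c i j
    (x := x t) (y := d - a - x t) (by have := hx t; omega)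
  refine ⟨M, hM, containsForms_of_monomial_mem fun m hm => ?_⟩
  have hm' : m 0 + m 1 + m 2 + m 3 = d := by
    rw [← hm, Finsupp.degree_eq_sum, Fin.sum_univ_four]
  rw [monomial_eq, C_1, one_mul, Finsupp.prod_fintype _ _ (fun _ => pow_zero _),
    Fin.prod_univ_four]
  by_cases h2 : m 2 = 0
  swap
  · refine Ideal.mul_mem_right _ _ (Ideal.mul_mem_left _ _ ?_)
    exact Ideal.pow_mem_of_mem _ (X_mem_cofactorIdeal M _ (by simp)) _ (by omega)
  by_cases h3 : m 3 = 0
  swap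
  · refine Ideal.mul_mem_left _ _ ?_
    exact Ideal.pow_mem_of_mem _ (X_mem_cofactorIdeal M _ (by simp)) _ (by omega)
  have ht : m 0 / (a + 1) < Fintype.card τ := by
    rw [Nat.div_lt_iff_lt_mul (by omega)]
    omega
  let t : τ := e.symm ⟨m 0 / (a + 1), ht⟩
  have hxt : x t = min (m 0 / (a + 1) * (a + 1)) (d - a) := by simp [x, t]
  have hle : x t ≤ m 0 := by
    rw [hxt]
    exact (min_le_left _ _).trans (Nat.div_mul_le_self _ _)
  have hle' : d - a - x t ≤ m 1 := by
    have := Nat.lt_div_mul_add (a := m 0) (b := a + 1) (by omega)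
    omega
  have hmem : X 0 ^ x t * X 1 ^ (d - a - x t) ∈ cofactorIdeal M {(i, j)} {2, 3} := by
    have h1 := adjugate_mem_cofactorIdeal M {2, 3} t (Set.mem_singleton (i, j))
    rw [hε] at h1
    have h2 := Ideal.mul_mem_left _ (((ε t : ℤ) : MvPolynomial (Fin 4) ℂ)) h1
    rwa [← mul_assoc, ← Int.cast_mul, ← Units.val_mul, Int.units_mul_self, Units.val_one,
      Int.cast_one, one_mul] at h2
  rw [h2, h3, pow_zero, pow_zero, mul_one, mul_one]
  exact Ideal.mem_of_dvd _ (mul_dvd_mul (pow_dvd_pow _ hle) (pow_dvd_pow _ hle')) hmem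

end MonomialMatrices

section Induction

variable {n : Type*} [Fintype n] [DecidableEq n] {τ : Type*}

omit [Fintype n] [DecidableEq n] in
theorem HasDegrees.transpose {σ : Type*} {M : Matrix n n (MvPolynomial σ ℂ)} {b c : n → ℕ}
    (h : HasDegrees M b c) : HasDegrees M.transpose c b :=
  fun i j => add_comm (b j) (c i) ▸ h j i

theorem cofactorIdeal_transpose {σ : Type*} (M : τ → Matrix n n (MvPolynomial σ ℂ))
    (S : Set (n × n)) (E : Set σ) :
    cofactorIdeal (fun t => (M t).transpose) (Prod.swap ⁻¹' S) E = cofactorIdeal M S E := by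
  refine le_antisymm (cofactorIdeal_le (fun t i j h => ?_) fun v hv => X_mem_cofactorIdeal _ _ hv)
    (cofactorIdeal_le (fun t i j h => ?_) fun v hv => X_mem_cofactorIdeal _ _ hv)
  · rw [← Matrix.adjugate_transpose, Matrix.transpose_apply]
    exact adjugate_mem_cofactorIdeal M E t h
  · have := adjugate_mem_cofactorIdeal (fun t => (M t).transpose) (S := Prod.swap ⁻¹' S) E t
      (i := j) (j := i) h
    rwa [← Matrix.adjugate_transpose, Matrix.transpose_apply] at this

variable [Fintype τ]

theorem exists_containsForms_of_update {σ : Type*} [Finite σ] {b c : n → ℕ} {j : n} {e d : ℕ}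
    (hj : c j = e + 1) {S S₁ : Set (n × n)} {E : Set σ} (v : σ) (hS : S₁ ⊆ S)
    (hS₁ : ∀ p ∈ S₁, p.2 = j)
    (h : ∃ M : τ → Matrix n n (MvPolynomial σ ℂ), (∀ t, HasDegrees (M t) b (Function.update c j e)) ∧
      ContainsForms d (cofactorIdeal M S E))
    (h₁ : ∃ M : τ → Matrix n n (MvPolynomial σ ℂ), (∀ t, HasDegrees (M t) b c) ∧
      ContainsForms (d + 1) (cofactorIdeal M S₁ (insert v E))) :
    ∃ M : τ → Matrix n n (MvPolynomial σ ℂ), (∀ t, HasDegrees (M t) b c) ∧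
      ContainsForms (d + 1) (cofactorIdeal M S E) := by
  classical
  obtain ⟨M₀, hM₀, hF₀⟩ := h
  obtain ⟨N, hN, hFN⟩ := h₁
  have hN₁ : ∀ t, HasDegrees ((N t).updateCol j 0) b (Function.update c j e) := by
    intro t r s
    by_cases hs : s = j
    · subst hs
      rw [Matrix.updateCol_self]
      exact isHomogeneous_zero _ _ _
    · rw [Matrix.updateCol_ne hs, Function.update_of_ne hs]
      exact hN t r s
  have hFN₁ : ContainsForms (d + 1) (cofactorIdeal (fun t => (N t).updateCol j 0) S₁ (insert v E)) := by
    refine hFN.mono (cofactorIdeal_le (fun t r s hrs => ?_) fun w hw => X_mem_cofactorIdeal _ _ hw)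
    obtain rfl : s = j := hS₁ _ hrs
    rw [← adjugate_updateCol_self (N t) r s 0]
    exact adjugate_mem_cofactorIdeal (fun t => (N t).updateCol s 0) _ t hrs
  obtain ⟨M', hM', h₀, h₁⟩ := exists_containsForms_and hM₀ hN₁ hF₀ hFN₁
  let M : τ → Matrix n n (MvPolynomial σ ℂ) := fun t =>
    (M' t).updateCol j ((X v : MvPolynomial σ ℂ) • (M' t).col j)
  have hM : ∀ t, HasDegrees (M t) b c := by
    intro t r s
    by_cases hs : s = j
    · subst hs
      have h2 := (isHomogeneous_X ℂ v).mul (hM' t r s)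
      rw [Function.update_self, show 1 + (b r + e) = b r + c s by omega] at h2
      simpa [M] using h2
    · have h2 := hM' t r s
      rw [Function.update_of_ne hs] at h2
      simpa [M, hs] using h2
  have hadj : ∀ t r, (M t).adjugate j r = (M' t).adjugate j r := fun t r =>
    adjugate_updateCol_self _ _ _ _
  have hadj' : ∀ t r s, s ≠ j → (M t).adjugate s r = X v * (M' t).adjugate s r := fun t r s hs =>
    adjugate_updateCol_smul _ hs _ _
  have := Fintype.ofFinite S
  have := Fintype.ofFinite E
  refine ⟨M, hM, containsForms_succ (isHomogeneous_cofactorFamily hM S E) (isHomogeneous_X ℂ v)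
    (h₁.mono (cofactorIdeal_le (fun t r s hrs => ?_) fun w hw => ?_)) fun H hH => ?_⟩
  · refine Ideal.mem_sup_left ?_
    obtain rfl : s = j := hS₁ _ hrs
    rw [← hadj]
    exact adjugate_mem_cofactorIdeal M E t (hS hrs)
  · rcases hw with rfl | hw
    · exact Ideal.mem_sup_right (Ideal.mem_span_singleton_self _)
    · exact Ideal.mem_sup_left (X_mem_cofactorIdeal M S hw)
  · refine mul_mem_of_mem_cofactorIdeal (fun t r s hrs => ?_)
      (fun w hw => X_mem_cofactorIdeal M S hw) (h₀ H hH)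
    have h2 := adjugate_mem_cofactorIdeal M E t hrs
    by_cases hs : s = j
    · subst hs
      rw [hadj] at h2
      exact Ideal.mul_mem_left _ _ h2
    · rwa [hadj' t r s hs] at h2

theorem sum_update_add_one {c : n → ℕ} {j : n} {e : ℕ} (hj : c j = e + 1) :
    ∑ r, Function.update c j e r + 1 = ∑ r, c r := by
  rw [← Finset.add_sum_erase _ _ (Finset.mem_univ j), ← Finset.add_sum_erase _ c (Finset.mem_univ j),
    Function.update_self, Finset.sum_congr rfl fun r hr =>
      Function.update_of_ne (Finset.ne_of_mem_erase hr) _ _]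
  omega

theorem exists_containsForms_row_of_update {b c : n → ℕ} {i j : n} {e : ℕ} (hb : ∀ r, b r ≤ b i)
    (hc : ∀ r, c r ≤ c j) (hj : c j = e + 1) (hcard : Fintype.card n ≤ Fintype.card τ)
    (h : ∃ M : τ → Matrix n n (MvPolynomial (Fin 4) ℂ),
      (∀ t, HasDegrees (M t) b (Function.update c j e)) ∧
      ContainsForms (∑ r, b r + ∑ r, Function.update c j e r)
        (cofactorIdeal M {p | p.1 = i} {3})) :
    ∃ M : τ → Matrix n n (MvPolynomial (Fin 4) ℂ), (∀ t, HasDegrees (M t) b c) ∧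
      ContainsForms (∑ r, b r + ∑ r, c r) (cofactorIdeal M {p | p.1 = i} {3}) := by
  have hs := sum_update_add_one hj
  rw [← hs, ← add_assoc]
  refine exists_containsForms_of_update (S₁ := {(i, j)}) hj 2 (by simp) (by simp) h ?_
  refine exists_containsForms_single b c i j (by omega) ?_
  rw [add_assoc, hs]
  have h1 : ∑ r, b r + ∑ r, c r ≤ Fintype.card n * (b i + c j) := by
    rw [← Finset.sum_add_distrib, ← Finset.card_univ, ← smul_eq_mul]
    exact Finset.sum_le_card_nsmul _ _ _ fun r _ => add_le_add (hb r) (hc r)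
  have h2 : 0 < Fintype.card n := Fintype.card_pos_iff.mpr ⟨i⟩
  have h3 := Nat.mul_le_mul_right (b i + c j) hcard
  rw [mul_add_one]
  omega

theorem adjugate_fromBlocks_one {R m : Type*} [CommRing R] [Fintype m] [DecidableEq m]
    (M : Matrix n n R) (i j : n) :
    (Matrix.fromBlocks M 0 0 (1 : Matrix m m R)).adjugate (Sum.inl j) (Sum.inl i) =
      M.adjugate j i := by
  have h : (Matrix.fromBlocks M 0 0 (1 : Matrix m m R)).updateRow (Sum.inl i)
      (Pi.single (Sum.inl j) 1) = Matrix.fromBlocks (M.updateRow i (Pi.single j 1)) 0 0 1 := by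
    ext (r | r) (s | s)
    · by_cases hr : r = i
      · subst hr
        simp [Pi.single_apply]
      · simp [Matrix.updateRow_apply, hr]
    · by_cases hr : r = i
      · subst hr
        simp
      · simp [Matrix.updateRow_apply, hr]
    · simp [Matrix.updateRow_apply]
    · simp [Matrix.updateRow_apply]
  rw [Matrix.adjugate_apply, Matrix.adjugate_apply, h, Matrix.det_fromBlocks_zero₂₁,
    Matrix.det_one, mul_one]

omit [Fintype τ] in
theorem exists_containsForms_row_of_subtype {σ : Type*} {b c : n → ℕ} {p : n → Prop}
    [DecidablePred p] (hb : ∀ r, ¬ p r → b r = 0) (hc : ∀ r, ¬ p r → c r = 0) {d : ℕ} {i : n}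
    (hi : p i) {E : Set σ}
    (h : ∃ M : τ → Matrix {r // p r} {r // p r} (MvPolynomial σ ℂ),
      (∀ t, HasDegrees (M t) (fun r => b r) (fun r => c r)) ∧
      ContainsForms d (cofactorIdeal M {q | q.1 = ⟨i, hi⟩} E)) :
    ∃ M : τ → Matrix n n (MvPolynomial σ ℂ), (∀ t, HasDegrees (M t) b c) ∧
      ContainsForms d (cofactorIdeal M {q | q.1 = i} E) := by
  obtain ⟨M', hM', hF⟩ := h
  let f := Equiv.sumCompl p
  let N : τ → Matrix ({r // p r} ⊕ {r // ¬ p r}) ({r // p r} ⊕ {r // ¬ p r}) (MvPolynomial σ ℂ) :=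
    fun t => Matrix.fromBlocks (M' t) 0 0 1
  refine ⟨fun t => (N t).submatrix f.symm f.symm, fun t r s => ?_,
    hF.mono (cofactorIdeal_le (fun t r s hrs => ?_) fun v hv => X_mem_cofactorIdeal _ _ hv)⟩
  · obtain ⟨r, rfl⟩ := f.surjective r
    obtain ⟨s, rfl⟩ := f.surjective s
    suffices h : (N t r s).IsHomogeneous (b (f r) + c (f s)) by simpa using h
    rcases r with r | r <;> rcases s with s | s
    · exact hM' t r s
    · exact isHomogeneous_zero _ _ _
    · exact isHomogeneous_zero _ _ _
    · have hbr : b (f (Sum.inr r)) = 0 := hb _ r.2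
      have hcs : c (f (Sum.inr s)) = 0 := hc _ s.2
      rw [hbr, hcs]
      simp only [N, Matrix.fromBlocks_apply₂₂, Matrix.one_apply]
      split_ifs
      · exact isHomogeneous_one _ _
      · exact isHomogeneous_zero _ _ _
  · obtain rfl : r = ⟨i, hi⟩ := hrs
    have h1 := adjugate_mem_cofactorIdeal (fun t => (N t).submatrix f.symm f.symm)
      (S := {q | q.1 = i}) E t (i := i) (j := s) rfl
    rw [Matrix.adjugate_submatrix_equiv_self, Matrix.submatrix_apply,
      Equiv.sumCompl_symm_apply_of_pos hi, Equiv.sumCompl_symm_apply_of_pos s.2,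
      adjugate_fromBlocks_one] at h1
    exact h1

omit [Fintype τ] in
theorem exists_containsForms_of_eq_zero {σ : Type*} [Nonempty τ] {b c : n → ℕ}
    (hb : ∀ r, b r = 0) (hc : ∀ r, c r = 0) {S : Set (n × n)} {i : n} (hi : (i, i) ∈ S) (E : Set σ)
    (d : ℕ) :
    ∃ M : τ → Matrix n n (MvPolynomial σ ℂ), (∀ t, HasDegrees (M t) b c) ∧
      ContainsForms d (cofactorIdeal M S E) := by
  refine ⟨fun _ => 1, fun t r s => ?_, ?_⟩
  · change ((1 : Matrix n n (MvPolynomial σ ℂ)) r s).IsHomogeneous _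
    rw [hb, hc, Matrix.one_apply]
    split_ifs
    · exact isHomogeneous_one _ _
    · exact isHomogeneous_zero _ _ _
  · have h := adjugate_mem_cofactorIdeal (fun _ : τ => (1 : Matrix n n (MvPolynomial σ ℂ))) E
      (Classical.arbitrary τ) hi
    rw [Matrix.adjugate_one, Matrix.one_apply_eq, ← Ideal.eq_top_iff_one] at h
    rw [h]
    exact fun F _ => Submodule.mem_top

theorem exists_containsForms_row {τ : Type*} [Fintype τ] (N : ℕ) :
    ∀ (n : Type) [Fintype n] [DecidableEq n] (b c : n → ℕ) (i : n), (∀ r, b r ≤ b i) →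
      Fintype.card n ≤ Fintype.card τ → ∑ r, b r + ∑ r, c r + Fintype.card n = N →
      ∃ M : τ → Matrix n n (MvPolynomial (Fin 4) ℂ), (∀ t, HasDegrees (M t) b c) ∧
        ContainsForms (∑ r, b r + ∑ r, c r) (cofactorIdeal M {p | p.1 = i} {3}) := by
  induction N using Nat.strong_induction_on with
  | _ N ih =>
  intro n _ _ b c i hb hcard hN
  have : Nonempty n := ⟨i⟩
  obtain ⟨j, hj⟩ := Finite.exists_max c
  rcases Nat.eq_zero_or_eq_succ_pred (c j) with h0 | hsucc
  swap
  · refine exists_containsForms_row_of_update hb hj hsucc hcard (ih _ ?_ n b _ i hb hcard rfl)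
    have := sum_update_add_one hsucc
    omega
  have hc : ∀ r, c r = 0 := fun r => Nat.le_zero.mp (h0 ▸ hj r)
  by_cases hi : b i = 0
  · have : Nonempty τ := Fintype.card_pos_iff.mp (Fintype.card_pos.trans_le hcard)
    exact exists_containsForms_of_eq_zero (fun r => Nat.le_zero.mp ((hb r).trans_eq hi)) hc
      (S := {p | p.1 = i}) (i := i) (Set.mem_ofPred_eq ▸ rfl) _ _
  by_cases hr : ∃ r, b r = 0
  · obtain ⟨r, hr⟩ := hr
    have hir : i ≠ r := fun h => hi (h ▸ hr)
    have hbr : ∀ s, ¬ s ≠ r → b s = 0 := fun s hs => (not_not.mp hs) ▸ hr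
    have hsum : ∀ f : n → ℕ, (∀ s, ¬ s ≠ r → f s = 0) → ∑ s : {s // s ≠ r}, f s = ∑ s, f s := by
      intro f hf
      rw [← Fintype.sum_subtype_add_sum_subtype (fun s => s ≠ r) f,
        Fintype.sum_eq_zero (fun s : {s // ¬ s ≠ r} => f s) fun s => hf s s.2, add_zero]
    have hlt : Fintype.card {s // s ≠ r} < Fintype.card n :=
      Fintype.card_subtype_lt (x := r) (by simp)
    refine exists_containsForms_row_of_subtype (p := fun s => s ≠ r) hbr (fun s _ => hc s) hir ?_
    rw [← hsum b hbr, ← hsum c fun s _ => hc s]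
    refine ih _ ?_ _ _ _ _ (fun s => hb s) (hlt.le.trans hcard) rfl
    rw [hsum b hbr, hsum c fun s _ => hc s]
    omega
  · have hpos : ∀ r, 1 ≤ b r := fun r => Nat.one_le_iff_ne_zero.mpr fun h => hr ⟨r, h⟩
    have h1 : ∑ r, (b r - 1) + ∑ r : n, 1 = ∑ r, b r + ∑ r, c r := by
      rw [← Finset.sum_add_distrib, ← Finset.sum_add_distrib]
      exact Finset.sum_congr rfl fun r _ => by have := hpos r; have := hc r; omega
    obtain ⟨M, hM, hF⟩ := exists_containsForms_row_of_update (τ := τ) (b := fun r => b r - 1)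
      (c := fun _ : n => 1) (i := i) (j := i) (e := 0) (fun r => Nat.sub_le_sub_right (hb r) 1)
      (fun _ => le_rfl) rfl hcard
      (ih _ (by
        have := sum_update_add_one (c := fun _ : n => 1) (j := i) (e := 0) rfl
        omega) n _ _ i (fun r => Nat.sub_le_sub_right (hb r) 1) hcard rfl)
    refine ⟨M, fun t r s => ?_, h1 ▸ hF⟩
    have h2 := hM t r s
    rwa [Nat.sub_add_cancel (hpos r), ← add_zero (b r), ← hc s] at h2

theorem exists_containsForms {τ : Type*} [Fintype τ] {n : Type} [Fintype n] [DecidableEq n]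
    [Nonempty n] (hcard : Fintype.card n ≤ Fintype.card τ) (d : ℕ) :
    ∀ b c : n → ℕ, ∑ r, b r + ∑ r, c r = d →
      ∃ M : τ → Matrix n n (MvPolynomial (Fin 4) ℂ), (∀ t, HasDegrees (M t) b c) ∧
        ContainsForms d (cofactorIdeal M Set.univ ∅) := by
  induction d with
  | zero =>
    intro b c h
    have hb : ∀ r, b r = 0 := by
      have : ∑ r, b r = 0 := by omega
      simpa using this
    have hc : ∀ r, c r = 0 := by
      have : ∑ r, c r = 0 := by omega
      simpa using this
    have : Nonempty τ := Fintype.card_pos_iff.mp (Fintype.card_pos.trans_le hcard)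
    exact exists_containsForms_of_eq_zero hb hc (Set.mem_univ (Classical.arbitrary n, _)) _ _
  | succ d ih =>
    have key : ∀ b c : n → ℕ, ∑ r, b r + ∑ r, c r = d + 1 → (∃ r, c r ≠ 0) →
        ∃ M : τ → Matrix n n (MvPolynomial (Fin 4) ℂ), (∀ t, HasDegrees (M t) b c) ∧
          ContainsForms (d + 1) (cofactorIdeal M Set.univ ∅) := by
      intro b c h ⟨r, hr⟩
      obtain ⟨j, hj⟩ := Finite.exists_max c
      have hsucc := Nat.exists_eq_succ_of_ne_zero (n := c j) (by have := hj r; omega)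
      obtain ⟨e, he⟩ := hsucc
      have hs := sum_update_add_one he
      refine exists_containsForms_of_update (S₁ := Prod.swap ⁻¹' {p | p.1 = j}) he 3
        (Set.subset_univ _) (fun p hp => hp) (ih _ _ (by omega)) ?_
      obtain ⟨M, hM, hF⟩ := exists_containsForms_row (τ := τ) _ n c b j hj hcard rfl
      refine ⟨fun t => (M t).transpose, fun t => (hM t).transpose, ?_⟩
      rwa [cofactorIdeal_transpose, insert_empty_eq, ← h, add_comm]
    intro b c h
    by_cases hc : ∃ r, c r ≠ 0
    · exact key b c h hc
    · obtain ⟨M, hM, hF⟩ := key c b (by omega) (by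
        by_contra hb
        push Not at hb hc
        simp [hb, hc] at h)
      refine ⟨fun t => (M t).transpose, fun t => (hM t).transpose, ?_⟩
      rwa [← Set.preimage_univ (f := Prod.swap), cofactorIdeal_transpose]

end Induction

section Dominance

variable {κ : Type*}

theorem totalDegree_pderiv_lt {ι K : Type*} [CommRing K] {Q : MvPolynomial ι K} {j : ι}
    (h : pderiv j Q ≠ 0) : (pderiv j Q).totalDegree < Q.totalDegree := by
  have h1 : ∀ m ∈ (pderiv j Q).support, (m.sum fun _ e => e) < Q.totalDegree := by
    intro m hm
    rw [mem_support_iff, coeff_pderiv] at hm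
    have h2 := le_totalDegree (mem_support_iff.mpr (left_ne_zero_of_mul hm))
    rw [Finsupp.sum_add_index' (fun _ => rfl) (fun _ _ _ => rfl), Finsupp.sum_single_index rfl] at h2
    exact h2
  obtain ⟨m, hm⟩ := support_nonempty.mpr h
  exact (Finset.sup_lt_iff (Nat.zero_le _ |>.trans_lt (h1 m hm))).mpr h1

theorem eq_C_of_pderiv_eq_zero {ι K : Type*} [Field K] [CharZero K] {Q : MvPolynomial ι K}
    (h : ∀ j, pderiv j Q = 0) : Q = C (coeff 0 Q) := by
  classical
  ext m
  rw [coeff_C]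
  split_ifs with hm
  · rw [hm]
  · obtain ⟨j, hj⟩ : ∃ j, m j ≠ 0 := by
      by_contra! h0
      exact hm (Finsupp.ext h0).symm
    have h1 := coeff_pderiv (i := j) Q (m - Finsupp.single j 1)
    have h2 : m - Finsupp.single j 1 + Finsupp.single j 1 = m :=
      tsub_add_cancel_of_le (Finsupp.single_le_iff.mpr (Nat.one_le_iff_ne_zero.mpr hj))
    rw [h, coeff_zero, h2] at h1
    refine (mul_eq_zero.mp h1.symm).resolve_right ?_
    exact Nat.cast_add_one_ne_zero _

theorem pderiv_aeval [Fintype κ] {ι K : Type*} [CommRing K] (φ : κ → MvPolynomial ι K) (i : ι)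
    (Q : MvPolynomial κ K) :
    pderiv i (aeval φ Q) = ∑ j, aeval φ (pderiv j Q) * pderiv i (φ j) := by
  classical
  induction Q using MvPolynomial.induction_on with
  | C a => simp [algebraMap_eq]
  | add p q hp hq => simp only [map_add, hp, hq, add_mul, Finset.sum_add_distrib]
  | mul_X p k hp =>
    simp only [map_mul, aeval_X, pderiv_mul, hp, map_add, add_mul, Finset.sum_add_distrib,
      pderiv_X]
    congr 1
    · rw [Finset.sum_mul]
      exact Finset.sum_congr rfl fun j _ => by ring
    · rw [Finset.sum_eq_single k]
      · simp
      · intro j _ hj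
        simp [hj.symm]
      · simp

/-- The Jacobian criterion for algebraic independence. -/
theorem aeval_injective_of_det_ne_zero [Fintype κ] [DecidableEq κ] {K : Type*} [Field K]
    [CharZero K] {φ : κ → MvPolynomial κ K}
    (hφ : (Matrix.of fun j i => pderiv i (φ j)).det ≠ 0) : Function.Injective (aeval (R := K) φ) := by
  rw [injective_iff_map_eq_zero]
  intro Q hQ
  induction hN : Q.totalDegree using Nat.strong_induction_on generalizing Q with
  | _ N ih =>
  have h1 : ∀ j, aeval φ (pderiv j Q) = 0 := by
    have h2 : (fun j => aeval φ (pderiv j Q)) = 0 := by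
      refine Matrix.eq_zero_of_vecMul_eq_zero hφ (funext fun i => ?_)
      have := pderiv_aeval φ i Q
      rw [hQ, map_zero] at this
      exact this.symm
    exact congrFun h2
  have h2 : ∀ j, pderiv j Q = 0 := by
    intro j
    by_contra hne
    exact hne (ih _ (hN ▸ totalDegree_pderiv_lt hne) _ (h1 j) rfl)
  have h3 := eq_C_of_pderiv_eq_zero h2
  rw [h3, aeval_C, algebraMap_eq, C_eq_zero] at hQ
  rw [h3, hQ, C_0]

theorem exists_ne_zero_forall_exists_eval_eq [Fintype κ] {K : Type*} [Field K] [IsAlgClosed K]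
    {φ : κ → MvPolynomial κ K} (hφ : Function.Injective (aeval (R := K) φ)) :
    ∃ f : MvPolynomial κ K, f ≠ 0 ∧
      ∀ y : κ → K, eval y f ≠ 0 → ∃ x : κ → K, ∀ j, eval x (φ j) = y j := by
  let θ : MvPolynomial κ K →+* MvPolynomial κ K := (aeval (R := K) φ).toRingHom
  have hθ : θ.FinitePresentation := by
    refine RingHom.FinitePresentation.of_comp_finiteType (g := θ) C ?_ ?_
    · have h1 : θ.comp C = C := by
        ext a
        simp [θ, algebraMap_eq]
      rw [h1]
      exact RingHom.finitePresentation_algebraMap.mpr inferInstance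
    · exact RingHom.finiteType_algebraMap.mpr inferInstance
  obtain ⟨S, hS⟩ := PrimeSpectrum.exists_constructibleSetData_iff.mpr
    (PrimeSpectrum.isConstructible_range_comap hθ)
  have hbot : (⊥ : PrimeSpectrum (MvPolynomial κ K)) ∈ Set.range (PrimeSpectrum.comap θ) := by
    refine ⟨⊥, ?_⟩
    ext x
    exact ⟨fun h => hφ (h.trans (map_zero _).symm), fun h => h ▸ map_zero θ⟩
  rw [← hS, PrimeSpectrum.ConstructibleSetData.toSet, Set.mem_iUnion₂] at hbot
  obtain ⟨T, hT, hT1, hT2⟩ := hbot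
  have hg : ∀ k, T.g k = 0 := by
    intro k
    simpa using hT1 ⟨k, rfl⟩
  refine ⟨T.f, fun h => hT2 (by simp [h]), fun y hy => ?_⟩
  let P : PrimeSpectrum (MvPolynomial κ K) := ⟨RingHom.ker (eval y), RingHom.ker_isPrime _⟩
  have hP : P ∈ Set.range (PrimeSpectrum.comap θ) := by
    rw [← hS, PrimeSpectrum.ConstructibleSetData.toSet, Set.mem_iUnion₂]
    refine ⟨T, hT, ?_, ?_⟩
    · rintro _ ⟨k, rfl⟩
      rw [hg]
      exact Ideal.zero_mem _
    · intro h
      exact hy (h rfl)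
  obtain ⟨q, hq⟩ := hP
  obtain ⟨I, hI, hqI⟩ := Ideal.exists_le_maximal q.asIdeal q.isPrime.ne_top
  obtain ⟨x, rfl⟩ := (isMaximal_iff_eq_vanishingIdeal_singleton (K := K)).mp hI
  refine ⟨x, fun j => ?_⟩
  have h1 : X j - C (y j) ∈ P.asIdeal := by simp [P, RingHom.mem_ker]
  rw [← hq] at h1
  have h2 : θ (X j - C (y j)) ∈ q.asIdeal := h1
  have h3 := hqI h2
  rw [mem_vanishingIdeal_singleton_iff] at h3
  simpa [θ, sub_eq_zero] using h3

end Dominance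

section Determinants

theorem derivation_prod {ι K A : Type*} [CommRing K] [CommRing A] [Algebra K A] [DecidableEq ι]
    (D : Derivation K A A) (s : Finset ι) (f : ι → A) :
    D (∏ i ∈ s, f i) = ∑ i ∈ s, D (f i) * ∏ k ∈ s.erase i, f k := by
  induction s using Finset.induction_on with
  | empty => simp
  | insert r s hr ih =>
    rw [Finset.prod_insert hr, Derivation.leibniz, ih, Finset.sum_insert hr,
      Finset.erase_insert hr, smul_eq_mul, smul_eq_mul, add_comm, Finset.mul_sum]
    congr 1
    · ring
    · refine Finset.sum_congr rfl fun i hi => ?_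
      have hir : r ≠ i := fun h => hr (h ▸ hi)
      rw [Finset.erase_insert_of_ne hir, Finset.prod_insert fun h => hr (Finset.mem_of_mem_erase h)]
      ring

variable {n : Type*} [Fintype n] [DecidableEq n]

/-- Jacobi's formula for the derivative of a determinant. -/
theorem derivation_det {K A : Type*} [CommRing K] [CommRing A] [Algebra K A]
    (D : Derivation K A A) (M : Matrix n n A) :
    D M.det = ∑ j, ∑ i, M.adjugate j i * D (M i j) := by
  have h : ∀ j, ∑ i, M.adjugate j i * D (M i j) = (M.updateCol j fun i => D (M i j)).det := by
    intro j
    rw [← Matrix.cramer_apply, Matrix.cramer_eq_adjugate_mulVec]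
    rfl
  simp only [h, Matrix.det_apply, map_sum, Units.smul_def, map_zsmul]
  rw [Finset.sum_comm]
  refine Finset.sum_congr rfl fun p _ => ?_
  rw [← Finset.smul_sum, derivation_prod]
  congr 1
  refine Finset.sum_congr rfl fun j _ => ?_
  rw [← Finset.mul_prod_erase _ _ (Finset.mem_univ j), Matrix.updateCol_self]
  congr 1
  exact Finset.prod_congr rfl fun k hk => (Matrix.updateCol_ne (Finset.ne_of_mem_erase hk)).symm

variable {σ τ : Type*}

theorem HasDegrees.det {M : Matrix n n (MvPolynomial σ ℂ)} {b c : n → ℕ} (hM : HasDegrees M b c) :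
    M.det.IsHomogeneous (∑ r, b r + ∑ r, c r) := by
  rw [Matrix.det_apply]
  refine IsHomogeneous.sum _ _ _ fun p _ => ?_
  rw [Units.smul_def]
  refine zsmul_mem (K := homogeneousSubmodule σ ℂ (∑ r, b r + ∑ r, c r))
    ((mem_homogeneousSubmodule _ _).mpr ?_) _
  have h := IsHomogeneous.prod Finset.univ (fun i => M (p i) i) (fun i => b (p i) + c i)
    fun i _ => hM (p i) i
  rwa [Finset.sum_add_distrib, Equiv.sum_comp p b] at h

variable [Fintype τ]

theorem exists_hasDegrees_sum_adjugate_mul_eq {b c : n → ℕ}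
    {M : τ → Matrix n n (MvPolynomial σ ℂ)} (hM : ∀ t, HasDegrees (M t) b c)
    {F : MvPolynomial σ ℂ} (hF : F.IsHomogeneous (∑ r, b r + ∑ r, c r))
    (hmem : F ∈ cofactorIdeal M Set.univ ∅) :
    ∃ H : τ → Matrix n n (MvPolynomial σ ℂ), (∀ t, HasDegrees (H t) b c) ∧
      ∑ t, ∑ j, ∑ i, (M t).adjugate j i * H t i j = F := by
  classical
  have := Fintype.ofFinite (Set.univ : Set (n × n))
  have := Fintype.ofFinite (∅ : Set σ)
  obtain ⟨h, hh, hs⟩ := exists_homogeneous_coeffs (isHomogeneous_cofactorFamily hM _ _) hF hmem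
  refine ⟨fun t => Matrix.of fun i j => h (Sum.inl (t, ⟨(i, j), Set.mem_univ _⟩)), fun t i j => ?_, ?_⟩
  · change (h (Sum.inl (t, ⟨(i, j), Set.mem_univ _⟩))).IsHomogeneous _
    rcases hh (Sum.inl (t, ⟨(i, j), Set.mem_univ _⟩)) with h0 | ⟨m, hm, hm'⟩
    · rw [h0]
      exact isHomogeneous_zero _ _ _
    · have h1 := sum_add_sum_sub_add b c i j
      simp only [cofactorDegree, Sum.elim_inl] at hm
      rwa [show b i + c j = m by omega]
  · rw [← hs, Fintype.sum_sum_type, Finset.univ_eq_empty (α := (∅ : Set σ)), Finset.sum_empty,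
      add_zero, Fintype.sum_prod_type]
    refine Finset.sum_congr rfl fun t _ => ?_
    rw [Finset.sum_comm, ← Fintype.sum_prod_type',
      ← (Equiv.Set.univ (n × n)).symm.sum_comp]
    exact Finset.sum_congr rfl fun p _ => mul_comm _ _

theorem exists_coeff_eq_and_eval_eq {κ K : Type*} [CommRing K]
    (g : MvPolynomial κ (MvPolynomial σ K)) (γ : σ →₀ ℕ) :
    ∃ f : MvPolynomial κ K, (∀ m, coeff m f = coeff γ (coeff m g)) ∧
      ∀ x : κ → K, eval x f = coeff γ (eval (fun k => C (x k)) g) := by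
  classical
  refine ⟨∑ m ∈ g.support, monomial m (coeff γ (coeff m g)), fun m => ?_, fun x => ?_⟩
  · simp only [coeff_sum, coeff_monomial, Finset.sum_ite_eq', mem_support_iff]
    split_ifs with h
    · rfl
    · rw [not_not.mp h, coeff_zero]
  · rw [map_sum, eval_eq, coeff_sum]
    refine Finset.sum_congr rfl fun m _ => ?_
    simp_rw [eval_monomial, ← C_pow, ← map_prod]
    rw [mul_comm (coeff m g), coeff_C_mul, mul_comm]
    rfl

theorem constantCoeff_pderiv {κ K : Type*} [CommRing K] (f : MvPolynomial κ K) (k : κ) :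
    constantCoeff (pderiv k f) = coeff (Finsupp.single k 1) f := by
  rw [constantCoeff_eq, coeff_pderiv]
  simp

theorem exists_ne_zero_forall_exists_sum_det_eq [Finite σ] {b c : n → ℕ} {d : ℕ}
    (hd : ∑ r, b r + ∑ r, c r = d) {M : τ → Matrix n n (MvPolynomial σ ℂ)}
    (hM : ∀ t, HasDegrees (M t) b c) (hF : ContainsForms d (cofactorIdeal M Set.univ ∅)) :
    ∃ f : MvPolynomial {m : σ →₀ ℕ // m.degree = d} ℂ, f ≠ 0 ∧
      ∀ y : {m : σ →₀ ℕ // m.degree = d} → ℂ, eval y f ≠ 0 →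
        ∃ N : τ → Matrix n n (MvPolynomial σ ℂ), (∀ t, HasDegrees (N t) b c) ∧
          ∀ γ, coeff γ.1 (∑ t, (N t).det) = y γ := by
  classical
  subst hd
  set d := ∑ r, b r + ∑ r, c r
  have : Finite {m : σ →₀ ℕ // m.degree = d} := (Finsupp.finite_of_degree_eq d).to_subtype
  have := Fintype.ofFinite {m : σ →₀ ℕ // m.degree = d}
  set κ := {m : σ →₀ ℕ // m.degree = d}
  choose H hH hHs using fun β : κ => exists_hasDegrees_sum_adjugate_mul_eq hM
    (isHomogeneous_monomial (1 : ℂ) β.2) (hF _ (isHomogeneous_monomial (1 : ℂ) β.2))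
  let G : τ → Matrix n n (MvPolynomial κ (MvPolynomial σ ℂ)) := fun t =>
    Matrix.of fun i j => C (M t i j) + ∑ β, X β * C (H β t i j)
  have hG0 : ∀ t, (constantCoeff : MvPolynomial κ (MvPolynomial σ ℂ) →+* _).mapMatrix (G t) =
      M t := by
    intro t
    refine Matrix.ext fun i j => ?_
    simp [G]
  have hG1 : ∀ β t i j, pderiv β (G t i j) = C (H β t i j) := by
    intro β t i j
    simp [G, pderiv_X, Pi.single_apply]
    exact (Fintype.sum_eq_single β fun x hx => if_neg hx).trans (if_pos rfl)
  choose φ hφ hφx using fun γ : κ => exists_coeff_eq_and_eval_eq (∑ t, (G t).det) γ.1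
  have hlin : ∀ β : κ, coeff (Finsupp.single β 1) (∑ t, (G t).det) = monomial β.1 1 := by
    intro β
    rw [← constantCoeff_pderiv, ← hHs β, map_sum, map_sum]
    refine Finset.sum_congr rfl fun t _ => ?_
    rw [derivation_det]
    simp_rw [map_sum, map_mul, hG1, constantCoeff_C]
    have h1 := (constantCoeff : MvPolynomial κ (MvPolynomial σ ℂ) →+* _).map_adjugate (G t)
    rw [hG0] at h1
    rw [← h1]
    rfl
  have hdet : (Matrix.of fun j i => pderiv i (φ j)).det ≠ 0 := by
    intro h0
    have h1 := (constantCoeff : MvPolynomial κ ℂ →+* ℂ).map_det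
      (Matrix.of fun j i => pderiv i (φ j))
    have h2 : (constantCoeff : MvPolynomial κ ℂ →+* ℂ).mapMatrix
        (Matrix.of fun j i => pderiv i (φ j)) = 1 := by
      ext j i
      rw [RingHom.mapMatrix_apply, Matrix.map_apply, Matrix.of_apply, constantCoeff_pderiv, hφ,
        hlin, coeff_monomial, Matrix.one_apply]
      exact if_congr (eq_comm.trans Subtype.ext_iff.symm) rfl rfl
    rw [h0, h2, map_zero, Matrix.det_one] at h1
    exact zero_ne_one h1
  obtain ⟨f, hf, hfy⟩ := exists_ne_zero_forall_exists_eval_eq (aeval_injective_of_det_ne_zero hdet)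
  refine ⟨f, hf, fun y hy => ?_⟩
  obtain ⟨x, hx⟩ := hfy y hy
  refine ⟨fun t => (eval fun k => C (x k)).mapMatrix (G t), fun t i j => ?_, fun γ => ?_⟩
  · have h1 : (eval fun k => C (x k)).mapMatrix (G t) i j =
        M t i j + ∑ β, C (x β) * H β t i j := by
      simp [G]
    have h2 : (M t i j + ∑ β, C (x β) * H β t i j).IsHomogeneous (b i + c j) :=
      (hM t i j).add (IsHomogeneous.sum _ _ _ fun β _ => (hH β t i j).C_mul _)
    rwa [← h1] at h2
  · rw [← hx, hφx, map_sum]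
    simp_rw [RingHom.map_det]

end Determinants

section Pfaffians

variable {n R : Type*} [Fintype n] [DecidableEq n] [CommRing R]

/-- The matrix on `n × Fin 2` with block `B` in position `(0, 1)` and zeros elsewhere. -/
def upperBlock (B : Matrix n n R) : Matrix (n × Fin 2) (n × Fin 2) R :=
  Matrix.of fun x y => if x.2 = 0 ∧ y.2 = 1 then B x.1 y.1 else 0

theorem sum_sign_smul_prod_upperBlock (B : Matrix n n R) :
    ∑ p : Equiv.Perm (n × Fin 2), (Equiv.Perm.sign p : ℤ) •
      ∏ i, upperBlock B (p (i, 0)) (p (i, 1)) = (Fintype.card n).factorial • B.det := by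
  have h1 : ∑ q : Fin 2 → Equiv.Perm n, ((Equiv.Perm.sign (q 0) * Equiv.Perm.sign (q 1) : ℤˣ) : ℤ) •
      ∏ i, B (q 0 i) (q 1 i) = (Fintype.card n).factorial • B.det := by
    rw [← (finTwoArrowEquiv (Equiv.Perm n)).symm.sum_comp, Fintype.sum_prod_type_right]
    have h2 : ∀ s : Equiv.Perm n, ∑ r : Equiv.Perm n,
        ((Equiv.Perm.sign r * Equiv.Perm.sign s : ℤˣ) : ℤ) • ∏ i, B (r i) (s i) = B.det := by
      intro s
      have h3 := Matrix.det_permute' s B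
      have h4 : ((Equiv.Perm.sign s : ℤ) : R) * ((Equiv.Perm.sign s : ℤ) : R) = 1 := by
        rw [← Int.cast_mul, ← Units.val_mul, Int.units_mul_self, Units.val_one, Int.cast_one]
      rw [← one_mul B.det, ← h4, mul_assoc, ← h3, Matrix.det_apply', Finset.mul_sum]
      refine Finset.sum_congr rfl fun r _ => ?_
      simp only [Units.val_mul, zsmul_eq_mul, Int.cast_mul, Matrix.submatrix_apply, id]
      ring
    simp only [finTwoArrowEquiv_symm_apply, Matrix.cons_val_zero, Matrix.cons_val_one, h2,
      Finset.sum_const, Finset.card_univ, Fintype.card_perm]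
  rw [← h1]
  symm
  refine Finset.sum_of_injOn (fun q => Equiv.prodCongrLeft q) ?_ ?_ ?_ ?_
  · intro q _ q' _ h
    funext j
    refine Equiv.ext fun i => ?_
    exact congrArg Prod.fst (Equiv.congr_fun h (i, j))
  · intro q _
    exact Finset.mem_coe.mpr (Finset.mem_univ _)
  · intro p _ hp
    have h2 : ∃ i, ¬((p (i, 0)).2 = 0 ∧ (p (i, 1)).2 = 1) := by
      by_contra! hc
      have h3 : ∀ x, (p x).2 = x.2 := by
        rintro ⟨i, j⟩
        fin_cases j
        · exact (hc i).1
        · exact (hc i).2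
      refine hp ⟨fun j => Equiv.ofBijective (fun i => (p (i, j)).1)
        (Finite.injective_iff_bijective.mp fun i i' h => ?_), Finset.mem_coe.mpr (Finset.mem_univ _),
        Equiv.ext fun x => ?_⟩
      · exact congrArg Prod.fst (p.injective (Prod.ext h ((h3 (i, j)).trans (h3 (i', j)).symm)))
      · exact Prod.ext rfl (h3 x).symm
    obtain ⟨i, hi⟩ := h2
    rw [Finset.prod_eq_zero (Finset.mem_univ i), smul_zero]
    exact if_neg hi
  · intro q _
    rw [Equiv.Perm.sign_prodCongrLeft, Fin.prod_univ_two]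
    simp [upperBlock]

theorem sum_sign_smul_prod_sub_transpose (N : Matrix (n × Fin 2) (n × Fin 2) R) :
    ∑ p : Equiv.Perm (n × Fin 2), (Equiv.Perm.sign p : ℤ) •
      ∏ i, (N - N.transpose) (p (i, 0)) (p (i, 1)) =
    2 ^ Fintype.card n • ∑ p : Equiv.Perm (n × Fin 2), (Equiv.Perm.sign p : ℤ) •
      ∏ i, N (p (i, 0)) (p (i, 1)) := by
  have h1 : ∀ (p : Equiv.Perm (n × Fin 2)) (i : n), (N - N.transpose) (p (i, 0)) (p (i, 1)) =
      ∑ s : Equiv.Perm (Fin 2), ((Equiv.Perm.sign s : ℤ) : R) * N (p (i, s 0)) (p (i, s 1)) := by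
    intro p i
    have h2 : (Finset.univ : Finset (Equiv.Perm (Fin 2))) = {1, Equiv.swap 0 1} := by decide
    rw [h2, Finset.sum_pair (by decide)]
    simp [sub_eq_add_neg]
  simp_rw [h1, Finset.prod_univ_sum, Finset.smul_sum]
  rw [Finset.sum_comm, Fintype.piFinset_univ]
  have h2 : ∀ w : n → Equiv.Perm (Fin 2), ∑ p : Equiv.Perm (n × Fin 2), (Equiv.Perm.sign p : ℤ) •
      ∏ i, (((Equiv.Perm.sign (w i) : ℤ) : R) * N (p (i, w i 0)) (p (i, w i 1))) =
      ∑ p : Equiv.Perm (n × Fin 2), (Equiv.Perm.sign p : ℤ) • ∏ i, N (p (i, 0)) (p (i, 1)) := by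
    intro w
    rw [← Equiv.sum_comp (Equiv.mulRight (Equiv.prodCongrRight w : Equiv.Perm (n × Fin 2)))
      (fun p => (Equiv.Perm.sign p : ℤ) • ∏ i, N (p (i, 0)) (p (i, 1)))]
    refine Finset.sum_congr rfl fun p _ => ?_
    rw [Finset.prod_mul_distrib, Equiv.coe_mulRight, Equiv.Perm.sign_mul,
      Equiv.Perm.sign_prodCongrRight]
    simp [mul_assoc]
  rw [Finset.sum_congr rfl fun w _ => h2 w, Finset.sum_const, Finset.card_univ, Fintype.card_fun,
    Fintype.card_perm, Fintype.card_fin, Nat.factorial_two, Finset.smul_sum]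

/-- The numbering of `Fin (2 * k)` that sends `(i, j)` to `2 * i + j`. -/
def pairEquiv (k : ℕ) : Fin k × Fin 2 ≃ Fin (2 * k) :=
  finProdFinEquiv.trans (finCongr (mul_comm k 2))

/-- The skew-symmetric matrix whose entries in position `(2 * i, 2 * j + 1)` are those of `B`, and
whose entries at positions of equal parity vanish. -/
def skewOfBlock {k : ℕ} (B : Matrix (Fin k) (Fin k) R) : Matrix (Fin (2 * k)) (Fin (2 * k)) R :=
  (upperBlock B - (upperBlock B).transpose).reindex (pairEquiv k) (pairEquiv k)

theorem isSkew_skewOfBlock {k : ℕ} (B : Matrix (Fin k) (Fin k) R) : IsSkew (skewOfBlock B) :=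
  fun _ _ => (neg_sub _ _).symm

theorem pfaff_skewOfBlock {σ : Type*} {k : ℕ} (B : Matrix (Fin k) (Fin k) (MvPolynomial σ ℂ)) :
    pfaff (skewOfBlock B) = B.det := by
  have h1 : ∑ p : Equiv.Perm (Fin (2 * k)), (Equiv.Perm.sign p : ℤ) •
      ∏ i : Fin k, skewOfBlock B (p ⟨2 * i.1, by have := i.2; omega⟩)
        (p ⟨2 * i.1 + 1, by have := i.2; omega⟩) = (2 ^ k * k.factorial) • B.det := by
    rw [← (pairEquiv k).permCongr.sum_comp]
    have h2 := sum_sign_smul_prod_sub_transpose (upperBlock B)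
    rw [sum_sign_smul_prod_upperBlock, Fintype.card_fin, smul_smul] at h2
    rw [← h2]
    refine Finset.sum_congr rfl fun p _ => ?_
    rw [Equiv.Perm.sign_permCongr]
    congr 1
    refine Finset.prod_congr rfl fun i _ => ?_
    have h3 : (⟨2 * i.1, by have := i.2; omega⟩ : Fin (2 * k)) = pairEquiv k (i, 0) :=
      Fin.ext (by simp [pairEquiv])
    have h4 : (⟨2 * i.1 + 1, by have := i.2; omega⟩ : Fin (2 * k)) = pairEquiv k (i, 1) :=
      Fin.ext (by simp [pairEquiv, add_comm])
    rw [h3, h4, skewOfBlock, Matrix.reindex_apply, Matrix.submatrix_apply,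
      Equiv.permCongr_apply, Equiv.permCongr_apply]
    simp only [Equiv.symm_apply_apply]
  rw [pfaff, h1, ← Nat.cast_smul_eq_nsmul ℂ, smul_smul, inv_mul_cancel₀, one_smul]
  exact Nat.cast_ne_zero.mpr (mul_ne_zero (pow_ne_zero _ two_ne_zero) k.factorial_ne_zero)

theorem exists_homogMat_eq_add {k d : ℕ} (hk : 0 < k) {A : Matrix (Fin (2 * k)) (Fin (2 * k)) ℕ}
    (hsym : A.IsSymm) (hhom : HomogMat A) (htr : A.trace = 2 * d) :
    ∃ b c : Fin k → ℕ, (∀ i j, A (pairEquiv k (i, 0)) (pairEquiv k (j, 1)) = b i + c j) ∧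
      ∑ i, b i + ∑ i, c i = d := by
  have : Nonempty (Fin k) := ⟨⟨0, hk⟩⟩
  obtain ⟨i₀, hi₀⟩ := Finite.exists_min fun i : Fin k =>
    A (pairEquiv k (i, 0)) (pairEquiv k (⟨0, hk⟩, 1))
  have h1 : ∀ i j, A (pairEquiv k (i, 0)) (pairEquiv k (j, 1)) =
      A (pairEquiv k (i, 0)) (pairEquiv k (⟨0, hk⟩, 1)) -
        A (pairEquiv k (i₀, 0)) (pairEquiv k (⟨0, hk⟩, 1)) +
      A (pairEquiv k (i₀, 0)) (pairEquiv k (j, 1)) := by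
    intro i j
    have h2 := hi₀ i
    have h3 := hhom (pairEquiv k (i, 0)) (pairEquiv k (j, 1)) (pairEquiv k (i₀, 0))
      (pairEquiv k (⟨0, hk⟩, 1))
    omega
  refine ⟨_, _, h1, ?_⟩
  rw [← Finset.sum_add_distrib, ← Finset.sum_congr rfl fun i _ => h1 i i]
  have h2 : ∀ i : Fin k, ∑ j : Fin 2, A (pairEquiv k (i, j)) (pairEquiv k (i, j)) =
      2 * A (pairEquiv k (i, 0)) (pairEquiv k (i, 1)) := by
    intro i
    have h3 := hhom (pairEquiv k (i, 0)) (pairEquiv k (i, 0)) (pairEquiv k (i, 1))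
      (pairEquiv k (i, 1))
    have h4 := hsym.apply (pairEquiv k (i, 0)) (pairEquiv k (i, 1))
    rw [Fin.sum_univ_two]
    omega
  rw [Matrix.trace, ← (pairEquiv k).sum_comp, Fintype.sum_prod_type] at htr
  simp only [Matrix.diag_apply, h2, ← Finset.mul_sum] at htr
  omega

theorem degMat_skewOfBlock {σ : Type*} {k : ℕ} {A : Matrix (Fin (2 * k)) (Fin (2 * k)) ℕ}
    (hsym : A.IsSymm) {b c : Fin k → ℕ}
    (hA : ∀ i j, A (pairEquiv k (i, 0)) (pairEquiv k (j, 1)) = b i + c j)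
    {B : Matrix (Fin k) (Fin k) (MvPolynomial σ ℂ)} (hB : HasDegrees B b c) :
    DegMat (skewOfBlock B) A := by
  have h1 : ∀ x y, (upperBlock B x y).IsHomogeneous (A (pairEquiv k x) (pairEquiv k y)) := by
    intro x y
    by_cases h : x.2 = 0 ∧ y.2 = 1
    · have h2 := hA x.1 y.1
      rw [← h.1, ← h.2] at h2
      have h3 : upperBlock B x y = B x.1 y.1 := if_pos h
      rw [h3, h2]
      exact hB x.1 y.1
    · have h3 : upperBlock B x y = 0 := if_neg h
      rw [h3]
      exact isHomogeneous_zero _ _ _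
  intro i j
  have h2 := h1 ((pairEquiv k).symm i) ((pairEquiv k).symm j)
  have h3 := h1 ((pairEquiv k).symm j) ((pairEquiv k).symm i)
  rw [Equiv.apply_symm_apply, Equiv.apply_symm_apply] at h2 h3
  rw [hsym.apply] at h3
  exact h2.sub h3

end Pfaffians

/-- Let `A` be a `2k × 2k` symmetric homogeneous matrix of non-negative
integers with trace `2d`. Then a general form of degree `d` in four variables is the sum
of the Pfaffians of `k` skew-symmetric matrices of forms, each with degree matrix `A`.
Genericity is expressed by a nonzero polynomial `P` in the coefficients of the form,
cutting out a nonempty Zariski-open subset of the space of forms of degree `d`. -/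
theorem general_quaternary_form_is_sum_of_k_pfaffians
    (k d : ℕ) (hk : 0 < k)
    (A : Matrix (Fin (2*k)) (Fin (2*k)) ℕ) (hsym : A.IsSymm) (hhom : HomogMat A)
    (htr : Matrix.trace A = 2 * d) :
    ∃ P : MvPolynomial ((Fin 4) →₀ ℕ) ℂ, P ≠ 0 ∧
      (∃ F : MvPolynomial (Fin 4) ℂ, F.IsHomogeneous d ∧
        MvPolynomial.eval (fun m => MvPolynomial.coeff m F) P ≠ 0) ∧
      ∀ F : MvPolynomial (Fin 4) ℂ, F.IsHomogeneous d →
        MvPolynomial.eval (fun m => MvPolynomial.coeff m F) P ≠ 0 →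
        ∃ M : Fin k → Matrix (Fin (2*k)) (Fin (2*k)) (MvPolynomial (Fin 4) ℂ),
          (∀ i, IsSkew (M i)) ∧ (∀ i, DegMat (M i) A) ∧
          F = ∑ i, pfaff (M i) := by
  have : Nonempty (Fin k) := ⟨⟨0, hk⟩⟩
  obtain ⟨b, c, hA, hd⟩ := exists_homogMat_eq_add hk hsym hhom htr
  obtain ⟨N₀, hN₀, hcont⟩ := exists_containsForms (τ := Fin k) (n := Fin k) le_rfl d b c hd
  obtain ⟨f, hf, hfy⟩ := exists_ne_zero_forall_exists_sum_det_eq hd hN₀ hcont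
  have heval : ∀ F : MvPolynomial (Fin 4) ℂ, eval (fun m => coeff m F) (rename Subtype.val f) =
      eval (fun γ : {m : Fin 4 →₀ ℕ // m.degree = d} => coeff γ.1 F) f :=
    fun F => eval_rename _ _ _
  refine ⟨rename Subtype.val f,
    (map_ne_zero_iff _ (rename_injective _ Subtype.val_injective)).mpr hf, ?_, fun F hF hFf => ?_⟩
  · obtain ⟨y, hy⟩ : ∃ y, eval y f ≠ 0 := by
      by_contra! hc
      exact hf (MvPolynomial.funext fun y => by rw [hc, map_zero])
    obtain ⟨N, hN, hNy⟩ := hfy y hy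
    refine ⟨∑ t, (N t).det, IsHomogeneous.sum _ _ _ fun t _ => hd ▸ (hN t).det, ?_⟩
    simpa only [heval, hNy] using hy
  · rw [heval] at hFf
    obtain ⟨N, hN, hNF⟩ := hfy _ hFf
    refine ⟨fun t => skewOfBlock (N t), fun t => isSkew_skewOfBlock _,
      fun t => degMat_skewOfBlock hsym hA (hN t), ?_⟩
    simp_rw [pfaff_skewOfBlock]
    have hdet : (∑ t, (N t).det).IsHomogeneous d :=
      IsHomogeneous.sum _ _ _ fun t _ => hd ▸ (hN t).det
    ext m
    by_cases hm : m.degree = d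
    · exact (hNF ⟨m, hm⟩).symm
    · rw [hF.coeff_eq_zero hm, hdet.coeff_eq_zero hm]
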